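/- arXiv:2109.07524 — 7 statements merged into one kernel-verified Lean document; each statement's English description precedes it below -/
import Mathlib

section
/- Let S and T be nonempty finite sets of points in the Euclidean plane, and let G be the bipartite graph constructed from S and T as described in the context. If there exists a many-to-many matching between S and T of cost C, then G has a perfect matching of cost at most C. -/
open Classical

noncomputable section

/-- A point in the Euclidean plane. -/
abbrev Pt : Type := EuclideanSpace ℝ (Fin 2)

/-- `M` is a many-to-many matching between the planar point sets `S` and `T`:
a set of pairs `(p, q)` with `p ∈ S`, `q ∈ T` such that every point of `S` occurs
as a first coordinate and every point of `T` occurs as a second coordinate. -/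
def IsMMM (S T : Finset Pt) (M : Finset (Pt × Pt)) : Prop :=
  (∀ e ∈ M, e.1 ∈ S ∧ e.2 ∈ T) ∧
  (∀ p ∈ S, ∃ q, (p, q) ∈ M) ∧
  (∀ q ∈ T, ∃ p, (p, q) ∈ M)

/-- The cost of a set of pairs: the sum of the Euclidean distances of the pairs. -/
def mmCost (M : Finset (Pt × Pt)) : ℝ := ∑ e ∈ M, dist e.1 e.2

/-- The distance from `x` to a nearest point of `A`. -/
def minDistTo (A : Finset Pt) (x : Pt) : ℝ := sInf ((fun a => dist x a) '' (A : Set Pt))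

/-- The edges of the constructed bipartite graph `G`.  The `R`-side is `Pt ⊕ Pt`
(`Sum.inl u` for `u ∈ R₀ = S`, `Sum.inr v` for the copy `v̂ ∈ R₁` of `v ∈ T`), and the
`B`-side is `Pt ⊕ Pt` (`Sum.inl v` for `v ∈ B₀ = T`, `Sum.inr u` for the copy `û ∈ B₁`
of `u ∈ S`). -/
def IsGEdge (S T : Finset Pt) : (Pt ⊕ Pt) × (Pt ⊕ Pt) → Prop
  | (Sum.inl u, Sum.inl v) => u ∈ S ∧ v ∈ T          -- E₀ = R₀ × B₀
  | (Sum.inr v, Sum.inr u) => v ∈ T ∧ u ∈ S          -- E₁ = R₁ × B₁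
  | (Sum.inl u, Sum.inr u') => u ∈ S ∧ u' = u        -- E₂ = {(u, û) : u ∈ S}
  | (Sum.inr v, Sum.inl v') => v ∈ T ∧ v' = v        -- E₃ = {(v̂, v) : v ∈ T}

/-- The weights of the edges of the constructed bipartite graph `G`. -/
def edgeWeight (S T : Finset Pt) : (Pt ⊕ Pt) × (Pt ⊕ Pt) → ℝ
  | (Sum.inl u, Sum.inl v) => dist u v               -- E₀ edges: Euclidean distance
  | (Sum.inr _, Sum.inr _) => 0                      -- E₁ edges: weight 0
  | (Sum.inl u, Sum.inr _) => minDistTo T u          -- E₂ edges: distance to nearest point of T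
  | (Sum.inr v, Sum.inl _) => minDistTo S v          -- E₃ edges: distance to nearest point of S

/-- `M` is a perfect matching in the constructed bipartite graph `G`: a set of edges of `G`
such that every vertex of `R ∪ B` lies in exactly one of them. -/
def IsPM (S T : Finset Pt) (M : Finset ((Pt ⊕ Pt) × (Pt ⊕ Pt))) : Prop :=
  (∀ e ∈ M, IsGEdge S T e) ∧
  (∀ u ∈ S, ∃! e, e ∈ M ∧ e.1 = Sum.inl u) ∧         -- each vertex of R₀
  (∀ v ∈ T, ∃! e, e ∈ M ∧ e.1 = Sum.inr v) ∧         -- each vertex of R₁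
  (∀ v ∈ T, ∃! e, e ∈ M ∧ e.2 = Sum.inl v) ∧         -- each vertex of B₀
  (∀ u ∈ S, ∃! e, e ∈ M ∧ e.2 = Sum.inr u)           -- each vertex of B₁

/-- The cost of a perfect matching in `G`: the sum of the weights of its edges. -/
def pmCost (S T : Finset Pt) (M : Finset ((Pt ⊕ Pt) × (Pt ⊕ Pt))) : ℝ :=
  ∑ e ∈ M, edgeWeight S T e

theorem minDistTo_le {A : Finset Pt} {x a : Pt} (ha : a ∈ A) : minDistTo A x ≤ dist x a :=
  csInf_le ⟨0, by rintro _ ⟨b, -, rfl⟩; exact dist_nonneg⟩ ⟨a, ha, rfl⟩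

/-- `P` is a one-to-one partial matching: distinct pairs of `P` share no coordinate. -/
def IsPartialMatching {α β : Type*} (P : Finset (α × β)) : Prop :=
  (∀ a b c, (a, b) ∈ P → (a, c) ∈ P → b = c) ∧ ∀ a b c, (a, c) ∈ P → (b, c) ∈ P → a = b

/-- Every finite relation contains a partial matching meeting all of its pairs. -/
theorem exists_isPartialMatching_forall_mem {α β : Type*} (M : Finset (α × β)) :
    ∃ P ⊆ M, IsPartialMatching P ∧
      ∀ a b, (a, b) ∈ M → (∃ c, (a, c) ∈ P) ∨ ∃ c, (c, b) ∈ P := by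
  obtain ⟨P, hP, hmax⟩ := (M.powerset.filter IsPartialMatching).exists_max_image Finset.card
    ⟨∅, by simp [IsPartialMatching]⟩
  simp only [Finset.mem_filter, Finset.mem_powerset] at hP hmax
  refine ⟨P, hP.1, hP.2, fun a b hab => ?_⟩
  by_contra! h
  obtain ⟨ha, hb⟩ := h
  have hle := hmax (insert (a, b) P) ⟨Finset.insert_subset hab hP.1, by
    obtain ⟨h₁, h₂⟩ := hP.2
    constructor <;> intro x y z <;> simp only [Finset.mem_insert, Prod.mk.injEq] <;> grind⟩
  rw [Finset.card_insert_of_notMem (ha b)] at hle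
  omega

/-- The edges of `G` obtained from a partial matching `P`: the pairs of `P`, the swapped pairs
between the copies, and the edge joining each unmatched point to its own copy. -/
def perfectMatchingOf (S T : Finset Pt) (P : Finset (Pt × Pt)) :
    Finset ((Pt ⊕ Pt) × (Pt ⊕ Pt)) :=
  P.image (fun e => (Sum.inl e.1, Sum.inl e.2)) ∪
    P.image (fun e => (Sum.inr e.2, Sum.inr e.1)) ∪
    (S \ P.image Prod.fst).image (fun u => (Sum.inl u, Sum.inr u)) ∪
    (T \ P.image Prod.snd).image (fun v => (Sum.inr v, Sum.inl v))

section

variable {S T : Finset Pt} {P : Finset (Pt × Pt)} {u v : Pt}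

theorem inl_inl_mem_perfectMatchingOf :
    (Sum.inl u, Sum.inl v) ∈ perfectMatchingOf S T P ↔ (u, v) ∈ P := by
  simp [perfectMatchingOf]

theorem inr_inr_mem_perfectMatchingOf :
    (Sum.inr v, Sum.inr u) ∈ perfectMatchingOf S T P ↔ (u, v) ∈ P := by
  simp [perfectMatchingOf]

theorem inl_inr_mem_perfectMatchingOf :
    (Sum.inl u, Sum.inr v) ∈ perfectMatchingOf S T P ↔ v = u ∧ u ∈ S ∧ ∀ w, (u, w) ∉ P := by
  simp [perfectMatchingOf]; grind

theorem inr_inl_mem_perfectMatchingOf :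
    (Sum.inr u, Sum.inl v) ∈ perfectMatchingOf S T P ↔ v = u ∧ u ∈ T ∧ ∀ w, (w, u) ∉ P := by
  simp [perfectMatchingOf]; grind

theorem IsPartialMatching.isPM_perfectMatchingOf (hP : IsPartialMatching P)
    (hPS : ∀ e ∈ P, e.1 ∈ S ∧ e.2 ∈ T) : IsPM S T (perfectMatchingOf S T P) := by
  obtain ⟨h₁, h₂⟩ := hP
  have hll := @inl_inl_mem_perfectMatchingOf S T P
  have hrr := @inr_inr_mem_perfectMatchingOf S T P
  have hlr := @inl_inr_mem_perfectMatchingOf S T P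
  have hrl := @inr_inl_mem_perfectMatchingOf S T P
  refine ⟨?_, fun u hu => ?_, fun v hv => ?_, fun v hv => ?_, fun u hu => ?_⟩
  · rintro ⟨a | a, b | b⟩ he
    · exact hPS _ (hll.1 he)
    · exact ⟨(hlr.1 he).2.1, (hlr.1 he).1⟩
    · exact ⟨(hrl.1 he).2.1, (hrl.1 he).1⟩
    · exact (hPS _ (hrr.1 he)).symm
  · by_cases h : ∃ v, (u, v) ∈ P
    · obtain ⟨v, hv⟩ := h
      refine ⟨(Sum.inl u, Sum.inl v), ⟨hll.2 hv, rfl⟩, ?_⟩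
      rintro ⟨a, b | b⟩ ⟨he, rfl⟩ <;> grind
    · refine ⟨(Sum.inl u, Sum.inr u), ⟨hlr.2 ⟨rfl, hu, not_exists.1 h⟩, rfl⟩, ?_⟩
      rintro ⟨a, b | b⟩ ⟨he, rfl⟩ <;> grind
  · by_cases h : ∃ u, (u, v) ∈ P
    · obtain ⟨u, hu⟩ := h
      refine ⟨(Sum.inr v, Sum.inr u), ⟨hrr.2 hu, rfl⟩, ?_⟩
      rintro ⟨a, b | b⟩ ⟨he, rfl⟩ <;> grind
    · refine ⟨(Sum.inr v, Sum.inl v), ⟨hrl.2 ⟨rfl, hv, not_exists.1 h⟩, rfl⟩, ?_⟩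
      rintro ⟨a, b | b⟩ ⟨he, rfl⟩ <;> grind
  · by_cases h : ∃ u, (u, v) ∈ P
    · obtain ⟨u, hu⟩ := h
      refine ⟨(Sum.inl u, Sum.inl v), ⟨hll.2 hu, rfl⟩, ?_⟩
      rintro ⟨a | a, b⟩ ⟨he, rfl⟩ <;> grind
    · refine ⟨(Sum.inr v, Sum.inl v), ⟨hrl.2 ⟨rfl, hv, not_exists.1 h⟩, rfl⟩, ?_⟩
      rintro ⟨a | a, b⟩ ⟨he, rfl⟩ <;> grind
  · by_cases h : ∃ v, (u, v) ∈ P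
    · obtain ⟨v, hv⟩ := h
      refine ⟨(Sum.inr v, Sum.inr u), ⟨hrr.2 hv, rfl⟩, ?_⟩
      rintro ⟨a | a, b⟩ ⟨he, rfl⟩ <;> grind
    · refine ⟨(Sum.inl u, Sum.inr u), ⟨hlr.2 ⟨rfl, hu, not_exists.1 h⟩, rfl⟩, ?_⟩
      rintro ⟨a | a, b⟩ ⟨he, rfl⟩ <;> grind

theorem pmCost_perfectMatchingOf :
    pmCost S T (perfectMatchingOf S T P) =
      mmCost P + ∑ u ∈ S \ P.image Prod.fst, minDistTo T u +
        ∑ v ∈ T \ P.image Prod.snd, minDistTo S v := by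
  unfold pmCost perfectMatchingOf mmCost
  rw [Finset.sum_union, Finset.sum_union, Finset.sum_union, Finset.sum_image, Finset.sum_image,
    Finset.sum_image, Finset.sum_image]
  · simp [edgeWeight]
  all_goals first
    | (rw [Finset.disjoint_left]; rintro ⟨_ | _, _ | _⟩ <;> simp)
    | (intro x _ y _; simp [Prod.ext_iff]; try tauto)

end

/-- Nearest-neighbour distances of the points left unmatched by `P` are paid for by the pairs of
`M` outside `P`, provided that every pair of `M` meets `P`. -/
theorem IsMMM.mmCost_add_sum_minDistTo_le {S T : Finset Pt} {M P : Finset (Pt × Pt)}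
    (hM : IsMMM S T M) (hPM : P ⊆ M)
    (hmeet : ∀ a b, (a, b) ∈ M → (∃ c, (a, c) ∈ P) ∨ ∃ c, (c, b) ∈ P) :
    mmCost P + ∑ u ∈ S \ P.image Prod.fst, minDistTo T u +
      ∑ v ∈ T \ P.image Prod.snd, minDistTo S v ≤ mmCost M := by
  obtain ⟨hmem, hl, hr⟩ := hM
  choose! q hq using hl
  choose! p hp using hr
  set U := S \ P.image Prod.fst with hU
  set V := T \ P.image Prod.snd with hV
  have hUS : ∀ u ∈ U, u ∈ S := fun u hu => (Finset.mem_sdiff.1 hu).1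
  have hVT : ∀ v ∈ V, v ∈ T := fun v hv => (Finset.mem_sdiff.1 hv).1
  have hUP : ∀ u ∈ U, u ∉ P.image Prod.fst := fun u hu => (Finset.mem_sdiff.1 hu).2
  have hVP : ∀ v ∈ V, v ∉ P.image Prod.snd := fun v hv => (Finset.mem_sdiff.1 hv).2
  have hPU : Disjoint P (U.image fun u => (u, q u)) := by
    rw [Finset.disjoint_right]
    rintro e he heP
    obtain ⟨u, hu, rfl⟩ := Finset.mem_image.1 he
    exact hUP u hu (Finset.mem_image_of_mem Prod.fst heP)
  have hPUV : Disjoint (P ∪ U.image fun u => (u, q u)) (V.image fun v => (p v, v)) := by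
    rw [Finset.disjoint_right]
    rintro e he heP
    obtain ⟨v, hv, rfl⟩ := Finset.mem_image.1 he
    rcases Finset.mem_union.1 heP with h | h
    · exact hVP v hv (Finset.mem_image_of_mem Prod.snd h)
    · obtain ⟨u, hu, heq⟩ := Finset.mem_image.1 h
      obtain ⟨rfl, -⟩ := Prod.mk.inj heq
      rcases hmeet _ _ (hp v (hVT v hv)) with ⟨c, hc⟩ | ⟨c, hc⟩
      · exact hUP _ hu (Finset.mem_image_of_mem Prod.fst hc)
      · exact hVP v hv (Finset.mem_image_of_mem Prod.snd hc)
  calc _ ≤ mmCost P + ∑ u ∈ U, dist u (q u) + ∑ v ∈ V, dist (p v) v := by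
        gcongr with u hu v hv
        · exact minDistTo_le (hmem _ (hq u (hUS u hu))).2
        · rw [dist_comm]
          exact minDistTo_le (hmem _ (hp v (hVT v hv))).1
    _ = mmCost ((P ∪ U.image fun u => (u, q u)) ∪ V.image fun v => (p v, v)) := by
        unfold mmCost
        rw [Finset.sum_union hPUV, Finset.sum_union hPU, Finset.sum_image, Finset.sum_image]
        · exact fun _ _ _ _ h => (Prod.mk.inj h).2
        · exact fun _ _ _ _ h => (Prod.mk.inj h).1
    _ ≤ mmCost M := by
        refine Finset.sum_le_sum_of_subset_of_nonneg ?_ fun _ _ _ => dist_nonneg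
        refine Finset.union_subset (Finset.union_subset hPM ?_) ?_ <;>
          rw [Finset.image_subset_iff]
        · exact fun u hu => hq u (hUS u hu)
        · exact fun v hv => hp v (hVT v hv)

theorem many_to_many_matching_yields_perfect_matching
    (S T : Finset Pt) (hS : S.Nonempty) (hT : T.Nonempty)
    (M' : Finset (Pt × Pt)) (hM' : IsMMM S T M') (C : ℝ) (hC : mmCost M' = C) :
    ∃ M : Finset ((Pt ⊕ Pt) × (Pt ⊕ Pt)), IsPM S T M ∧ pmCost S T M ≤ C := by
  obtain ⟨P, hPM, hP, hmeet⟩ := exists_isPartialMatching_forall_mem M'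
  refine ⟨perfectMatchingOf S T P, hP.isPM_perfectMatchingOf fun e he => hM'.1 e (hPM he), ?_⟩
  rw [pmCost_perfectMatchingOf, ← hC]
  exact hM'.mmCost_add_sum_minDistTo_le hPM hmeet
end
end

section
/- Let S and T be nonempty finite sets of points in the Euclidean plane, and let G be the bipartite graph constructed from S and T as described in the context. If G has a perfect matching of cost C, then there exists a many-to-many matching between S and T of cost at most C. -/
open Classical

noncomputable section

/-- The distance to a nearest point of a nonempty finite set is attained. -/
theorem exists_dist_eq_minDistTo {A : Finset Pt} (hA : A.Nonempty) (x : Pt) :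
    ∃ a ∈ A, dist x a = minDistTo A x := by
  have h : minDistTo A x ∈ (fun a => dist x a) '' (A : Set Pt) :=
    Set.Nonempty.csInf_mem ((Finset.coe_nonempty.mpr hA).image _) (A.finite_toSet.image _)
  simpa using h

/-- The pairs contributed by an edge of `G`, where `s` and `t` choose a point of `S` and of `T`
for each point: an edge of `E₀` contributes itself, an edge of `E₁` contributes nothing, and the
edges `(u, û)` and `(v̂, v)` contribute `(u, t u)` and `(s v, v)`. -/
def edgePairs (s t : Pt → Pt) : (Pt ⊕ Pt) × (Pt ⊕ Pt) → Finset (Pt × Pt)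
  | (Sum.inl u, Sum.inl v) => {(u, v)}
  | (Sum.inr _, Sum.inr _) => ∅
  | (Sum.inl u, Sum.inr _) => {(u, t u)}
  | (Sum.inr v, Sum.inl _) => {(s v, v)}

theorem mmCost_edgePairs {S T : Finset Pt} {s t : Pt → Pt}
    (hs : ∀ x, dist x (s x) = minDistTo S x) (ht : ∀ x, dist x (t x) = minDistTo T x)
    (e : (Pt ⊕ Pt) × (Pt ⊕ Pt)) : mmCost (edgePairs s t e) = edgeWeight S T e := by
  rcases e with ⟨u | v, v' | u'⟩ <;> simp [edgePairs, edgeWeight, mmCost, ht, ← hs, dist_comm]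

theorem mmCost_biUnion_le {ι : Type*} (M : Finset ι) (f : ι → Finset (Pt × Pt)) :
    mmCost (M.biUnion f) ≤ ∑ e ∈ M, mmCost (f e) := by
  induction M using Finset.induction_on with
  | empty => simp [mmCost]
  | insert a M ha ih =>
    rw [Finset.biUnion_insert, Finset.sum_insert ha]
    have h : mmCost (f a ∪ M.biUnion f) + mmCost (f a ∩ M.biUnion f) =
        mmCost (f a) + mmCost (M.biUnion f) := Finset.sum_union_inter
    have h0 : 0 ≤ mmCost (f a ∩ M.biUnion f) := Finset.sum_nonneg fun _ _ => dist_nonneg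
    linarith

theorem isMMM_biUnion_edgePairs {S T : Finset Pt} {s t : Pt → Pt}
    (hs : ∀ x, s x ∈ S) (ht : ∀ x, t x ∈ T)
    {M : Finset ((Pt ⊕ Pt) × (Pt ⊕ Pt))} (hM : IsPM S T M) :
    IsMMM S T (M.biUnion (edgePairs s t)) := by
  obtain ⟨hE, hR, -, hB, -⟩ := hM
  refine ⟨fun p hp => ?_, fun u hu => ?_, fun v hv => ?_⟩
  · obtain ⟨e, he, hp⟩ := Finset.mem_biUnion.mp hp
    have h := hE e he
    rcases e with ⟨u | v, v' | u'⟩ <;> simp only [edgePairs, Finset.mem_singleton,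
      Finset.notMem_empty] at hp <;> subst hp
    · exact h
    · exact ⟨h.1, ht u⟩
    · exact ⟨hs v, h.1⟩
  · obtain ⟨⟨_, v | u'⟩, ⟨he, rfl⟩, -⟩ := hR u hu
    · exact ⟨v, Finset.mem_biUnion.mpr ⟨_, he, by simp [edgePairs]⟩⟩
    · exact ⟨t u, Finset.mem_biUnion.mpr ⟨_, he, by simp [edgePairs]⟩⟩
  · obtain ⟨⟨u | v', _⟩, ⟨he, rfl⟩, -⟩ := hB v hv
    · exact ⟨u, Finset.mem_biUnion.mpr ⟨_, he, by simp [edgePairs]⟩⟩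
    · obtain rfl : v = v' := (hE _ he).2
      exact ⟨s v, Finset.mem_biUnion.mpr ⟨_, he, by simp [edgePairs]⟩⟩

theorem perfect_matching_yields_many_to_many_matching
    (S T : Finset Pt) (hS : S.Nonempty) (hT : T.Nonempty)
    (M : Finset ((Pt ⊕ Pt) × (Pt ⊕ Pt))) (hM : IsPM S T M) (C : ℝ) (hC : pmCost S T M = C) :
    ∃ M' : Finset (Pt × Pt), IsMMM S T M' ∧ mmCost M' ≤ C := by
  choose s hs hs' using exists_dist_eq_minDistTo hS
  choose t ht ht' using exists_dist_eq_minDistTo hT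
  refine ⟨M.biUnion (edgePairs s t), isMMM_biUnion_edgePairs hs ht hM, ?_⟩
  calc mmCost (M.biUnion (edgePairs s t))
      ≤ ∑ e ∈ M, mmCost (edgePairs s t e) := mmCost_biUnion_le M _
    _ = pmCost S T M := Finset.sum_congr rfl fun e _ => mmCost_edgePairs hs' ht' e
    _ = C := hC
end
end

section
/- Let S and T be nonempty finite sets of points in the Euclidean plane and let M be a many-to-many matching between S and T. Suppose M contains three pairwise distinct pairs (u₁,v₁), (u₂,v₁), (u₂,v₂) (i.e., the pairs form a path of length three u₁–v₁–u₂–v₂ in the bipartite graph with edge set M). Then M with the middle pair (u₂,v₁) removed is still a many-to-many matching between S and T, and its cost is at most the cost of M. -/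
open Classical

noncomputable section

theorem remove_middle_edge_of_three_path
    (S T : Finset Pt) (hS : S.Nonempty) (hT : T.Nonempty)
    (M : Finset (Pt × Pt)) (hM : IsMMM S T M)
    (u₁ u₂ v₁ v₂ : Pt) (hu₁ : u₁ ∈ S) (hu₂ : u₂ ∈ S) (huu : u₁ ≠ u₂)
    (hv₁ : v₁ ∈ T) (hv₂ : v₂ ∈ T) (hvv : v₁ ≠ v₂)
    (h₁ : (u₁, v₁) ∈ M) (h₂ : (u₂, v₁) ∈ M) (h₃ : (u₂, v₂) ∈ M) :
    IsMMM S T (M.erase (u₂, v₁)) ∧ mmCost (M.erase (u₂, v₁)) ≤ mmCost M := by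
  refine ⟨⟨fun e he => hM.1 e (Finset.mem_of_mem_erase he), fun p hp => ?_, fun q hq => ?_⟩, ?_⟩
  · by_cases hpu : p = u₂
    · subst hpu
      exact ⟨v₂, Finset.mem_erase.2 ⟨fun h => hvv (Prod.ext_iff.1 h).2.symm, h₃⟩⟩
    · obtain ⟨q, hq⟩ := hM.2.1 p hp
      exact ⟨q, Finset.mem_erase.2 ⟨fun h => hpu (Prod.ext_iff.1 h).1, hq⟩⟩
  · by_cases hqv : q = v₁
    · subst hqv
      exact ⟨u₁, Finset.mem_erase.2 ⟨fun h => huu (Prod.ext_iff.1 h).1, h₁⟩⟩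
    · obtain ⟨p, hp⟩ := hM.2.2 q hq
      exact ⟨p, Finset.mem_erase.2 ⟨fun h => hqv (Prod.ext_iff.1 h).2, hp⟩⟩
  · exact Finset.sum_le_sum_of_subset_of_nonneg (Finset.erase_subset _ _)
      fun _ _ _ => dist_nonneg
end
end

section
/- Let S and T be nonempty finite sets of points in the Euclidean plane. For each p ∈ S let η(p) ∈ T be a point of T at minimum Euclidean distance from p, and for each q ∈ T let η(q) ∈ S be a point of S at minimum Euclidean distance from q. Then the many-to-many matching M = {(p, η(p)) : p ∈ S} ∪ {(η(q), q) : q ∈ T} has cost at most twice the minimum cost of a many-to-many matching between S and T. -/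
open Classical

noncomputable section

/-- If every element of `A` is the image under `f` of some element of `M` whose weight is at
least its own, then the total weight of `A` is at most that of `M`. -/
theorem sum_le_sum_of_cover {α β : Type*} [Nonempty β] (A : Finset α) (M : Finset β) (f : β → α)
    (g : α → ℝ) (w : β → ℝ) (hcover : ∀ a ∈ A, ∃ e ∈ M, f e = a)
    (hle : ∀ e ∈ M, g (f e) ≤ w e) (hw : ∀ e ∈ M, 0 ≤ w e) :
    ∑ a ∈ A, g a ≤ ∑ e ∈ M, w e := by
  choose! c hcM hc using hcover
  have hinj : Set.InjOn c A := fun a ha b hb hab => by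
    rw [← hc a ha, ← hc b hb, hab]
  calc ∑ a ∈ A, g a ≤ ∑ a ∈ A, w (c a) := Finset.sum_le_sum fun a ha => by
        simpa only [hc a ha] using hle (c a) (hcM a ha)
    _ = ∑ e ∈ A.image c, w e := (Finset.sum_image hinj).symm
    _ ≤ ∑ e ∈ M, w e := Finset.sum_le_sum_of_subset_of_nonneg
        (Finset.image_subset_iff.2 hcM) fun e he _ => hw e he

theorem mmCost_union_le (A B : Finset (Pt × Pt)) : mmCost (A ∪ B) ≤ mmCost A + mmCost B := by
  unfold mmCost
  rw [← Finset.sum_union_inter]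
  exact le_add_of_nonneg_right (Finset.sum_nonneg fun _ _ => dist_nonneg)

theorem nearest_neighbor_mmm_is_2_approximation
    (S T : Finset Pt) (hS : S.Nonempty) (hT : T.Nonempty)
    (ηS ηT : Pt → Pt)
    (hηS : ∀ p ∈ S, ηS p ∈ T ∧ ∀ q ∈ T, dist p (ηS p) ≤ dist p q)
    (hηT : ∀ q ∈ T, ηT q ∈ S ∧ ∀ p ∈ S, dist q (ηT q) ≤ dist q p) :
    mmCost ((S.image fun p => (p, ηS p)) ∪ (T.image fun q => (ηT q, q))) ≤
      2 * sInf {x : ℝ | ∃ M : Finset (Pt × Pt), IsMMM S T M ∧ mmCost M = x} := by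
  have hne : {x : ℝ | ∃ M : Finset (Pt × Pt), IsMMM S T M ∧ mmCost M = x}.Nonempty := by
    refine ⟨_, S ×ˢ T, ⟨fun e he => Finset.mem_product.1 he, fun p hp => ?_, fun q hq => ?_⟩, rfl⟩
    · exact hT.imp fun q hq => Finset.mk_mem_product hp hq
    · exact hS.imp fun p hp => Finset.mk_mem_product hp hq
  rw [← div_le_iff₀' (by norm_num : (0 : ℝ) < 2)]
  refine le_csInf hne ?_
  rintro _ ⟨M, ⟨hmem, hleft, hright⟩, rfl⟩
  rw [div_le_iff₀' (by norm_num : (0 : ℝ) < 2), two_mul]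
  refine (mmCost_union_le _ _).trans (add_le_add ?_ ?_)
  · unfold mmCost
    rw [Finset.sum_image fun _ _ _ _ h => congrArg Prod.fst h]
    refine sum_le_sum_of_cover S M Prod.fst _ _ (fun p hp => ?_)
      (fun e he => (hηS e.1 (hmem e he).1).2 e.2 (hmem e he).2) fun _ _ => dist_nonneg
    obtain ⟨q, hq⟩ := hleft p hp
    exact ⟨_, hq, rfl⟩
  · unfold mmCost
    rw [Finset.sum_image fun _ _ _ _ h => congrArg Prod.snd h]
    refine sum_le_sum_of_cover T M Prod.snd _ _ (fun q hq => ?_) (fun e he => ?_)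
      fun _ _ => dist_nonneg
    · obtain ⟨p, hp⟩ := hright q hq
      exact ⟨_, hp, rfl⟩
    · rw [dist_comm, dist_comm e.1]
      exact (hηT e.2 (hmem e he).2).2 e.1 (hmem e he).1
end
end

section
/- Let (R, B, E) be a finite bipartite graph with edge costs c, let y : R ∪ B → ℝ satisfy y(u) + y(v) ≤ c(u,v) + 1 for every edge (u,v) ∈ E, and let M ⊆ E be a perfect matching with y(u) + y(v) = c(u,v) for every (u,v) ∈ M (i.e., M is 1-optimal with dual y). Then for every perfect matching M' ⊆ E, c(M') ≥ c(M) − n, where n = |R|. -/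
open Classical

noncomputable section

/-- `M` is a matching in the bipartite graph with parts `α`, `β` and edge set `E`:
a set of edges in which no vertex occurs in two edges. -/
def IsBMatching {α β : Type*} (E M : Finset (α × β)) : Prop :=
  M ⊆ E ∧ ∀ e ∈ M, ∀ e' ∈ M, (e.1 = e'.1 ∨ e.2 = e'.2) → e = e'

/-- `M` is a perfect matching in the bipartite graph with parts `α`, `β` and edge set `E`:
a matching in which every vertex occurs in (exactly) one edge. -/
def IsBPerfectMatching {α β : Type*} [Fintype α] [Fintype β] (E M : Finset (α × β)) : Prop :=
  IsBMatching E M ∧ (∀ a : α, ∃ e ∈ M, e.1 = a) ∧ (∀ b : β, ∃ e ∈ M, e.2 = b)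

theorem IsBPerfectMatching.sum_fst {α β : Type*} [Fintype α] [Fintype β]
    {E M : Finset (α × β)} (hM : IsBPerfectMatching E M) (f : α → ℝ) :
    ∑ e ∈ M, f e.1 = ∑ a, f a :=
  Finset.sum_bij (fun e _ => e.1) (fun _ _ => Finset.mem_univ _)
    (fun e he e' he' h => hM.1.2 e he e' he' (Or.inl h))
    (fun a _ => by simpa using hM.2.1 a) (fun _ _ => rfl)

theorem IsBPerfectMatching.sum_snd {α β : Type*} [Fintype α] [Fintype β]
    {E M : Finset (α × β)} (hM : IsBPerfectMatching E M) (f : β → ℝ) :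
    ∑ e ∈ M, f e.2 = ∑ b, f b :=
  Finset.sum_bij (fun e _ => e.2) (fun _ _ => Finset.mem_univ _)
    (fun e he e' he' h => hM.1.2 e he e' he' (Or.inr h))
    (fun b _ => by simpa using hM.2.2 b) (fun _ _ => rfl)

/-- The dual values summed over the edges of a perfect matching give the total dual value. -/
theorem IsBPerfectMatching.sum_dual {α β : Type*} [Fintype α] [Fintype β]
    {E M : Finset (α × β)} (hM : IsBPerfectMatching E M) (y : α ⊕ β → ℝ) :
    ∑ e ∈ M, (y (Sum.inl e.1) + y (Sum.inr e.2)) = ∑ v, y v := by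
  rw [Finset.sum_add_distrib, hM.sum_fst fun a => y (Sum.inl a),
    hM.sum_snd fun b => y (Sum.inr b), Fintype.sum_sum_type]

/-- The cost of a 1-optimal matching exceeds the cost of any perfect matching
by at most `n = |R|`. -/
theorem one_optimal_matching_cost_bound
    {α β : Type*} [Fintype α] [Fintype β]
    (E : Finset (α × β)) (c : α × β → ℝ) (y : α ⊕ β → ℝ)
    (hfeas : ∀ e ∈ E, y (Sum.inl e.1) + y (Sum.inr e.2) ≤ c e + 1)
    (M : Finset (α × β)) (hM : IsBPerfectMatching E M)
    (htight : ∀ e ∈ M, y (Sum.inl e.1) + y (Sum.inr e.2) = c e) :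
    ∀ M' : Finset (α × β), IsBPerfectMatching E M' →
      (∑ e ∈ M, c e) - (Fintype.card α : ℝ) ≤ ∑ e ∈ M', c e := by
  intro M' hM'
  have hM_cost : ∑ e ∈ M, c e = ∑ v, y v :=
    (Finset.sum_congr rfl htight).symm.trans (hM.sum_dual y)
  have hM'_cost : ∑ v, y v ≤ ∑ e ∈ M', (c e + 1) :=
    (hM'.sum_dual y).symm.trans_le (Finset.sum_le_sum fun e he => hfeas e (hM'.1.1 he))
  rw [Finset.sum_add_distrib, hM'.sum_fst fun _ => (1 : ℝ)] at hM'_cost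
  simp only [Finset.sum_const, Finset.card_univ, nsmul_eq_mul, mul_one] at hM'_cost
  linarith
end
end

section
/- Let (R, B, E) be a finite bipartite graph with edge costs c and let M ⊆ E be a perfect matching. Then M is a minimum-cost perfect matching (c(M) ≤ c(M') for every perfect matching M') if and only if there is no alternating cycle with respect to M whose net-cost is negative. -/
open Classical

noncomputable section

/-- `(k, a, b)` describes an alternating cycle with respect to the matching `M` in the
bipartite graph with edge set `E`: the distinct vertices `a 0, b 0, a 1, b 1, …,
a (k-1), b (k-1)` traversed cyclically, with the matched edges `(a i, b i) ∈ M` and the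
unmatched edges `(a ((i+1) % k), b i) ∈ E \ M`. -/
def IsAltCycle {α β : Type*} (E M : Finset (α × β)) (k : ℕ) (a : ℕ → α) (b : ℕ → β) : Prop :=
  2 ≤ k ∧
  (∀ i < k, ∀ j < k, a i = a j → i = j) ∧
  (∀ i < k, ∀ j < k, b i = b j → i = j) ∧
  (∀ i < k, (a i, b i) ∈ M) ∧
  (∀ i < k, (a ((i + 1) % k), b i) ∈ E ∧ (a ((i + 1) % k), b i) ∉ M)

/-- The net-cost of an alternating cycle: the total cost of its unmatched edges minus the
total cost of its matched edges. -/
def cycleNetCost {α β : Type*} (c : α × β → ℝ) (k : ℕ) (a : ℕ → α) (b : ℕ → β) : ℝ :=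
  (∑ i ∈ Finset.range k, c (a ((i + 1) % k), b i)) - ∑ i ∈ Finset.range k, c (a i, b i)

theorem IsBPerfectMatching.exists_equiv {α β : Type*} [Fintype α] [Fintype β]
    {E M : Finset (α × β)} (hM : IsBPerfectMatching E M) :
    ∃ f : α ≃ β, ∀ a b, (a, b) ∈ M ↔ f a = b := by
  obtain ⟨⟨-, hinj⟩, hα, hβ⟩ := hM
  have hα' : ∀ a, ∃ b, (a, b) ∈ M := fun a ↦ by
    obtain ⟨⟨a', b⟩, h, rfl⟩ := hα a
    exact ⟨b, h⟩
  choose f hf using hα'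
  have hiff : ∀ a b, (a, b) ∈ M ↔ f a = b := fun a b ↦
    ⟨fun h ↦ congrArg Prod.snd (hinj _ (hf a) _ h (Or.inl rfl)), fun h ↦ h ▸ hf a⟩
  refine ⟨Equiv.ofBijective f ⟨fun x y hxy ↦ ?_, fun b ↦ ?_⟩, hiff⟩
  · exact congrArg Prod.fst (hinj _ (hf x) _ (hf y) (Or.inr hxy))
  · obtain ⟨⟨a, b'⟩, h, rfl⟩ := hβ b
    exact ⟨a, (hiff a b').1 h⟩

theorem isBPerfectMatching_image {α β : Type*} [Fintype α] [Fintype β]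
    {E : Finset (α × β)} (f : α ≃ β) (σ : Equiv.Perm α) (h : ∀ x, (σ x, f x) ∈ E) :
    IsBPerfectMatching E (Finset.univ.image fun x ↦ (σ x, f x)) := by
  refine ⟨⟨?_, ?_⟩, fun a ↦ ?_, fun b ↦ ?_⟩
  · intro e he
    obtain ⟨x, -, rfl⟩ := Finset.mem_image.1 he
    exact h x
  · intro e he e' he' hee
    obtain ⟨x, -, rfl⟩ := Finset.mem_image.1 he
    obtain ⟨y, -, rfl⟩ := Finset.mem_image.1 he'
    have hxy : x = y := hee.elim (fun h ↦ σ.injective h) (fun h ↦ f.injective h)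
    rw [hxy]
  · exact ⟨_, Finset.mem_image_of_mem _ (Finset.mem_univ (σ.symm a)), by simp⟩
  · exact ⟨_, Finset.mem_image_of_mem _ (Finset.mem_univ (f.symm b)), by simp⟩

theorem sum_image_perm_equiv {α β : Type*} [Fintype α] (f : α ≃ β) (σ : Equiv.Perm α)
    (c : α × β → ℝ) :
    ∑ e ∈ Finset.univ.image (fun x ↦ (σ x, f x)), c e = ∑ x, c (σ x, f x) :=
  Finset.sum_image fun _ _ _ _ h ↦ f.injective (congrArg Prod.snd h)

theorem eq_image_of_mem_iff {α β : Type*} [Fintype α] {M : Finset (α × β)} {f : α ≃ β}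
    {σ : Equiv.Perm α} (h : ∀ a b, (a, b) ∈ M ↔ f (σ.symm a) = b) :
    M = Finset.univ.image fun x ↦ (σ x, f x) := by
  ext ⟨a, b⟩
  simp only [h, Finset.mem_image, Finset.mem_univ, true_and, Prod.mk.injEq]
  constructor
  · rintro rfl
    exact ⟨σ.symm a, by simp⟩
  · rintro ⟨x, rfl, rfl⟩
    simp

/-- A sum over a finite type that is negative is negative along some orbit of any permutation. -/
theorem exists_sum_range_minimalPeriod_neg {α : Type*} [Fintype α] (σ : Equiv.Perm α)
    (F : α → ℝ) (h : ∑ x, F x < 0) :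
    ∃ x, ∑ i ∈ Finset.range (Function.minimalPeriod σ x), F (σ^[i] x) < 0 := by
  by_contra! hx
  refine h.not_ge ?_
  rw [Finset.sum_partition (Equiv.Perm.SameCycle.setoid σ)]
  refine Finset.sum_nonneg fun q hq ↦ ?_
  obtain ⟨x, -, rfl⟩ := Finset.mem_image.1 hq
  convert hx x using 1
  symm
  refine Finset.sum_bij (fun i _ ↦ σ^[i] x) ?_ ?_ ?_ fun _ _ ↦ rfl
  · intro i _
    refine Finset.mem_filter.2 ⟨Finset.mem_univ _, Quotient.sound ?_⟩
    change σ.SameCycle _ _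
    rw [Equiv.Perm.iterate_eq_pow, Equiv.Perm.sameCycle_pow_left]
  · intro i hi j hj hij
    exact Function.iterate_injOn_Iio_minimalPeriod (Finset.mem_range.1 hi)
      (Finset.mem_range.1 hj) hij
  · intro y hy
    have hxy : σ.SameCycle y x := Quotient.exact (Finset.mem_filter.1 hy).2
    obtain ⟨n, -, hn⟩ := hxy.symm.exists_pow_eq'
    have hpos : 0 < Function.minimalPeriod σ x :=
      Function.minimalPeriod_pos_of_mem_periodicPts
        (σ.injective.mem_periodicPts x)
    refine ⟨n % Function.minimalPeriod σ x, Finset.mem_range.2 (Nat.mod_lt _ hpos), ?_⟩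
    rw [Function.iterate_mod_minimalPeriod_eq, Equiv.Perm.iterate_eq_pow, hn]

/-- A perfect matching is a minimum-cost perfect matching if and only if there is no
negative net-cost alternating cycle with respect to it. -/
theorem perfect_matching_min_iff_no_negative_alternating_cycle
    {α β : Type*} [Fintype α] [Fintype β]
    (E : Finset (α × β)) (c : α × β → ℝ)
    (M : Finset (α × β)) (hM : IsBPerfectMatching E M) :
    (∀ M' : Finset (α × β), IsBPerfectMatching E M' → ∑ e ∈ M, c e ≤ ∑ e ∈ M', c e) ↔
      ¬ ∃ (k : ℕ) (a : ℕ → α) (b : ℕ → β),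
          IsAltCycle E M k a b ∧ cycleNetCost c k a b < 0 := by
  obtain ⟨f, hf⟩ := hM.exists_equiv
  have hfE : ∀ x, (x, f x) ∈ E := fun x ↦ hM.1.1 ((hf _ _).2 rfl)
  have hsum : ∑ e ∈ M, c e = ∑ x, c (x, f x) := by
    rw [eq_image_of_mem_iff (σ := 1) hf, sum_image_perm_equiv]
    rfl
  constructor
  · rintro hmin ⟨k, a, b, ⟨hk, ha, -, habM, habE⟩, hneg⟩
    have hb : ∀ i < k, b i = f (a i) := fun i hi ↦ ((hf _ _).1 (habM i hi)).symm
    set l : List α := (List.range k).map a with hl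
    have hnodup : l.Nodup :=
      List.Nodup.map_on
        (fun i hi j hj ↦ ha i (List.mem_range.1 hi) j (List.mem_range.1 hj)) List.nodup_range
    have hσ : ∀ i < k, l.formPerm (a i) = a ((i + 1) % k) := fun i hi ↦ by
      simpa [hl] using List.formPerm_apply_getElem l hnodup i (by simpa [hl] using hi)
    have hσ' : ∀ x, (¬ ∃ i < k, a i = x) → l.formPerm x = x := fun x hx ↦
      List.formPerm_apply_of_notMem (by simpa [hl] using hx)
    have hE : ∀ x, (l.formPerm x, f x) ∈ E := fun x ↦ by
      by_cases hx : ∃ i < k, a i = x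
      · obtain ⟨i, hi, rfl⟩ := hx
        rw [hσ i hi, ← hb i hi]
        exact (habE i hi).1
      · rw [hσ' x hx]
        exact hfE x
    have hle := hmin _ (isBPerfectMatching_image f l.formPerm hE)
    rw [sum_image_perm_equiv, hsum, ← sub_nonneg, ← Finset.sum_sub_distrib] at hle
    refine hneg.not_ge (hle.trans_eq ?_)
    have hinj : Set.InjOn a (Finset.range k) := fun i hi j hj ↦
      ha i (Finset.mem_range.1 hi) j (Finset.mem_range.1 hj)
    rw [cycleNetCost, ← Finset.sum_sub_distrib,
      ← Finset.sum_subset (Finset.subset_univ ((Finset.range k).image a)),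
      Finset.sum_image hinj]
    · refine Finset.sum_congr rfl fun i hi ↦ ?_
      rw [hσ i (Finset.mem_range.1 hi), hb i (Finset.mem_range.1 hi)]
    · intro x _ hx
      rw [hσ' x (by simpa using hx), sub_self]
  · intro hno M' hM'
    by_contra! hlt
    obtain ⟨g, hg⟩ := hM'.exists_equiv
    set σ : Equiv.Perm α := f.trans g.symm with hσ
    have hM'eq : M' = Finset.univ.image fun x ↦ (σ x, f x) :=
      eq_image_of_mem_iff fun a b ↦ by simp [hg, hσ]
    have hE : ∀ x, (σ x, f x) ∈ E := fun x ↦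
      hM'.1.1 ((hg _ _).2 (by simp [hσ]))
    rw [hM'eq, sum_image_perm_equiv, hsum, ← sub_neg, ← Finset.sum_sub_distrib] at hlt
    obtain ⟨x, hx⟩ := exists_sum_range_minimalPeriod_neg σ _ hlt
    set k := Function.minimalPeriod σ x with hkdef
    have hnext : ∀ i, σ^[(i + 1) % k] x = σ (σ^[i] x) := fun i ↦ by
      rw [hkdef, Function.iterate_mod_minimalPeriod_eq, Function.iterate_succ_apply']
    have hinj : ∀ i < k, ∀ j < k, σ^[i] x = σ^[j] x → i = j := fun i hi j hj h ↦
      Function.iterate_injOn_Iio_minimalPeriod hi hj h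
    have hk : 2 ≤ k := by
      by_contra! hk
      interval_cases hk' : k
      · simp at hx
      · have hfix : σ x = x := Function.minimalPeriod_eq_one_iff_isFixedPt.1 hkdef.symm
        simp [hfix] at hx
    have hne : ∀ i, σ (σ^[i] x) ≠ σ^[i] x := fun i h ↦ by
      rw [← Function.iterate_succ_apply' σ, Function.iterate_succ_apply] at h
      have hfix : σ x = x := σ.injective.iterate i h
      have := Function.minimalPeriod_eq_one_iff_isFixedPt.2 hfix
      omega
    refine hno ⟨k, fun i ↦ σ^[i] x, fun i ↦ f (σ^[i] x), ⟨hk, hinj, ?_, ?_, ?_⟩, ?_⟩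
    · exact fun i hi j hj h ↦ hinj i hi j hj (f.injective h)
    · exact fun i _ ↦ (hf _ _).2 rfl
    · intro i _
      simp only [hnext, hf]
      exact ⟨hE _, fun h ↦ hne i (f.injective h)⟩
    · rw [cycleNetCost, ← Finset.sum_sub_distrib]
      simpa only [hnext] using hx
end
end

section
/- Let (R, B, E) be a finite bipartite graph with edge costs c, let M ⊆ E be a matching that is 1-feasible with dual y, and let P be an augmenting path with respect to M all of whose edges are eligible. Define y' : R ∪ B → ℝ by y'(v) = y(v) − 1 for every vertex v ∈ B lying on P and y'(w) = y(w) for all other vertices w. Then the matching M ⊕ P = (M ∖ P) ∪ (P ∖ M) is 1-feasible with dual y'. -/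
open Classical

noncomputable section

/-- `(k, a, b)` describes an augmenting path with respect to the matching `M` in the
bipartite graph with edge set `E`: the path `a 0 – b 0 – a 1 – b 1 – ⋯ – a k – b k`
through distinct vertices, whose unmatched edges are `(a i, b i) ∈ E \ M` (for `0 ≤ i ≤ k`),
whose matched edges are `(a (i+1), b i) ∈ M` (for `0 ≤ i < k`), and whose two endpoints
`a 0` and `b k` are (distinct) free vertices. -/
def IsAugPath {α β : Type*} (E M : Finset (α × β)) (k : ℕ) (a : ℕ → α) (b : ℕ → β) : Prop :=
  (∀ i ≤ k, ∀ j ≤ k, a i = a j → i = j) ∧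
  (∀ i ≤ k, ∀ j ≤ k, b i = b j → i = j) ∧
  (∀ i ≤ k, (a i, b i) ∈ E ∧ (a i, b i) ∉ M) ∧
  (∀ i < k, (a (i + 1), b i) ∈ M) ∧
  (∀ e ∈ M, e.1 ≠ a 0) ∧
  (∀ e ∈ M, e.2 ≠ b k)

/-- The net-cost of an augmenting path: the total cost of its unmatched edges minus the
total cost of its matched edges. -/
def pathNetCost {α β : Type*} (c : α × β → ℝ) (k : ℕ) (a : ℕ → α) (b : ℕ → β) : ℝ :=
  (∑ i ∈ Finset.range (k + 1), c (a i, b i)) - ∑ i ∈ Finset.range k, c (a (i + 1), b i)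

/-- The set of edges of the augmenting path described by `(k, a, b)`. -/
def pathEdges {α β : Type*} (k : ℕ) (a : ℕ → α) (b : ℕ → β) : Finset (α × β) :=
  ((Finset.range (k + 1)).image fun i => (a i, b i)) ∪
    ((Finset.range k).image fun i => (a (i + 1), b i))

/-- The adjusted dual `y'`: `y'(v) = y(v) − 1` for the `β`-side vertices `b 0, …, b k`
lying on the path, and `y'(w) = y(w)` for all other vertices. -/
def adjustedDual {α β : Type*} (y : α ⊕ β → ℝ) (k : ℕ) (b : ℕ → β) : α ⊕ β → ℝ
  | Sum.inl u => y (Sum.inl u)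
  | Sum.inr v => if ∃ i ≤ k, b i = v then y (Sum.inr v) - 1 else y (Sum.inr v)

theorem mem_pathEdges {α β : Type*} {k : ℕ} {a : ℕ → α} {b : ℕ → β} {e : α × β} :
    e ∈ pathEdges k a b ↔ (∃ i ≤ k, (a i, b i) = e) ∨ ∃ i < k, (a (i + 1), b i) = e := by
  simp [pathEdges]

/-- An edge of the matching that meets an augmenting path on the `α`-side lies on the path. -/
theorem IsAugPath.mem_pathEdges_of_fst_eq {α β : Type*} {E M : Finset (α × β)}
    {k : ℕ} {a : ℕ → α} {b : ℕ → β} (hM : IsBMatching E M) (hP : IsAugPath E M k a b)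
    {e : α × β} (he : e ∈ M) {i : ℕ} (hi : i ≤ k) (h : e.1 = a i) :
    e ∈ pathEdges k a b := by
  obtain ⟨-, -, -, hmat, hfree, -⟩ := hP
  cases i with
  | zero => exact absurd h (hfree e he)
  | succ j =>
    exact mem_pathEdges.2 (.inr ⟨j, hi, (hM.2 e he _ (hmat j hi) (.inl h)).symm⟩)

/-- An edge of the matching that meets an augmenting path on the `β`-side lies on the path. -/
theorem IsAugPath.mem_pathEdges_of_snd_eq {α β : Type*} {E M : Finset (α × β)}
    {k : ℕ} {a : ℕ → α} {b : ℕ → β} (hM : IsBMatching E M) (hP : IsAugPath E M k a b)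
    {e : α × β} (he : e ∈ M) {i : ℕ} (hi : i ≤ k) (h : e.2 = b i) :
    e ∈ pathEdges k a b := by
  obtain ⟨-, -, -, hmat, -, hfree⟩ := hP
  rcases hi.eq_or_lt with rfl | hlt
  · exact absurd h (hfree e he)
  · exact mem_pathEdges.2 (.inr ⟨i, hlt, (hM.2 e he _ (hmat i hlt) (.inr h)).symm⟩)

/-- An edge of the augmented matching is either an edge of the old matching disjoint from the
path, or one of the previously unmatched edges of the path. -/
theorem IsAugPath.cases_of_mem_augment {α β : Type*} {E M : Finset (α × β)}
    {k : ℕ} {a : ℕ → α} {b : ℕ → β} (hM : IsBMatching E M) (hP : IsAugPath E M k a b)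
    {e : α × β} (he : e ∈ (M \ pathEdges k a b) ∪ (pathEdges k a b \ M)) :
    (e ∈ M ∧ (∀ i ≤ k, e.1 ≠ a i) ∧ ∀ i ≤ k, e.2 ≠ b i) ∨ ∃ i ≤ k, (a i, b i) = e := by
  rcases Finset.mem_union.1 he with h | h
  · obtain ⟨heM, hnot⟩ := Finset.mem_sdiff.1 h
    exact .inl ⟨heM, fun i hi h => hnot (hP.mem_pathEdges_of_fst_eq hM heM hi h),
      fun i hi h => hnot (hP.mem_pathEdges_of_snd_eq hM heM hi h)⟩
  · obtain ⟨hmem, hnot⟩ := Finset.mem_sdiff.1 h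
    rcases mem_pathEdges.1 hmem with hi | ⟨i, hi, rfl⟩
    · exact .inr hi
    · exact absurd (hP.2.2.2.1 i hi) hnot

/-- Augmenting a 1-feasible matching along an augmenting path of eligible edges, and
decreasing the dual value of every `β`-side vertex on the path by one, yields a matching
`M ⊕ P` that is 1-feasible with the adjusted dual.  (An unmatched edge is eligible when
`y(u) + y(v) = c(u,v) + 1`; matched edges are always eligible.) -/
theorem augment_preserves_one_feasibility
    {α β : Type*} [Fintype α] [Fintype β]
    (E : Finset (α × β)) (c : α × β → ℝ)
    (M : Finset (α × β)) (hM : IsBMatching E M)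
    (y : α ⊕ β → ℝ)
    (hfeas : ∀ e ∈ E, y (Sum.inl e.1) + y (Sum.inr e.2) ≤ c e + 1)
    (htight : ∀ e ∈ M, y (Sum.inl e.1) + y (Sum.inr e.2) = c e)
    (k : ℕ) (a : ℕ → α) (b : ℕ → β) (hP : IsAugPath E M k a b)
    (heligible : ∀ i ≤ k, y (Sum.inl (a i)) + y (Sum.inr (b i)) = c (a i, b i) + 1) :
    IsBMatching E ((M \ pathEdges k a b) ∪ (pathEdges k a b \ M)) ∧
    (∀ e ∈ E, adjustedDual y k b (Sum.inl e.1) + adjustedDual y k b (Sum.inr e.2) ≤ c e + 1) ∧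
    (∀ e ∈ (M \ pathEdges k a b) ∪ (pathEdges k a b \ M),
        adjustedDual y k b (Sum.inl e.1) + adjustedDual y k b (Sum.inr e.2) = c e) := by
  refine ⟨⟨fun e he => ?_, fun e he e' he' h => ?_⟩, fun e he => ?_, fun e he => ?_⟩
  · rcases hP.cases_of_mem_augment hM he with ⟨heM, -⟩ | ⟨i, hi, rfl⟩
    · exact hM.1 heM
    · exact (hP.2.2.1 i hi).1
  · rcases hP.cases_of_mem_augment hM he with ⟨heM, hα, hβ⟩ | ⟨i, hi, rfl⟩ <;>
      rcases hP.cases_of_mem_augment hM he' with ⟨heM', hα', hβ'⟩ | ⟨j, hj, rfl⟩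
    · exact hM.2 e heM e' heM' h
    · exact (h.elim (hα j hj) (hβ j hj)).elim
    · exact (h.elim (fun h => hα' i hi h.symm) (fun h => hβ' i hi h.symm)).elim
    · obtain rfl : i = j := h.elim (hP.1 i hi j hj) (hP.2.1 i hi j hj)
      rfl
  · have := hfeas e he
    simp only [adjustedDual]
    split_ifs <;> linarith
  · rcases hP.cases_of_mem_augment hM he with ⟨heM, -, hβ⟩ | ⟨i, hi, rfl⟩
    · have hoff : ¬ ∃ i ≤ k, b i = e.2 := fun ⟨i, hi, h⟩ => hβ i hi h.symm
      simpa only [adjustedDual, if_neg hoff] using htight e heM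
    · have hon : ∃ j ≤ k, b j = b i := ⟨i, hi, rfl⟩
      simp only [adjustedDual, if_pos hon]
      linarith [heligible i hi]
end
end
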